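/- Let 0 < a < b ≤ 1 and δ > 0. Then liminf_{n→∞, n even} (4/n²) ln ∫_{Σ_{n,a,b,δ}} Z_n^{−1} |Δ(μ)|² e^{−Σ_{j=1}^{n/2} μ_j²/2} dμ ≥ 1 − b + ln b. -/

import Mathlib

open MeasureTheory

noncomputable section

/-- The open Weyl chamber `Σ_n`: strictly decreasing positive vectors. -/
def SigmaN (m : ℕ) : Set (Fin m → ℝ) :=
  {μ | (∀ i j : Fin m, i < j → μ j < μ i) ∧ ∀ i, 0 < μ i}

/-- The Vandermonde-type determinant `Δ(μ) = ∏_{i<j} (μ_i² − μ_j²)`. -/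
def VdM (m : ℕ) (μ : Fin m → ℝ) : ℝ :=
  ∏ p ∈ Finset.univ.filter (fun p : Fin m × Fin m => p.1 < p.2), (μ p.1 ^ 2 - μ p.2 ^ 2)

/-- The normalization constant `Z_n = (π/2)^{n/4} ∏_{j=0}^{n/2−1} (2j)!`. -/
def Zn (n : ℕ) : ℝ :=
  (Real.pi / 2) ^ ((n : ℝ) / 4) * ∏ j ∈ Finset.range (n / 2), (Nat.factorial (2 * j) : ℝ)


/-- The set `Σ_{n,a,b,δ} = Σ_{n,a,b} \ Σ_{n,>δ}`; on `Σ_n` the largest coordinate is `μ_1`,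
so the condition `μ_1² ≤ δ·C(n,2)` is expressed as `∀ i, μ i ^ 2 ≤ δ·C(n,2)`. -/
def SigABD (n : ℕ) (a b δ : ℝ) : Set (Fin (n / 2) → ℝ) :=
  {μ | μ ∈ SigmaN (n / 2) ∧
    (a * (n.choose 2 : ℝ) < ∑ j, μ j ^ 2 ∧ ∑ j, μ j ^ 2 < b * (n.choose 2 : ℝ)) ∧
    ∀ i, μ i ^ 2 ≤ δ * (n.choose 2 : ℝ)}

open Polynomial in
/-- Every polynomial is integrable against the Gaussian weight. -/
lemma integrable_eval_mul_gaussian (p : ℝ[X]) :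
    Integrable (fun x : ℝ => p.eval x * Real.exp (-x ^ 2 / 2)) := by
  induction p using Polynomial.induction_on' with
  | add p q hp hq =>
    simp only [eval_add, add_mul]
    exact hp.add hq
  | monomial n a =>
    have h := (integrable_rpow_mul_exp_neg_mul_sq (b := 1 / 2) (by norm_num)
      (s := (n : ℝ)) (by linarith [n.cast_nonneg (α := ℝ)])).const_mul a
    refine h.congr (Filter.Eventually.of_forall fun x => ?_)
    simp only [eval_monomial, Real.rpow_natCast, mul_assoc]
    ring_nf

/-- The integral of a polynomial against the weight `exp (-x² / 2)`. -/
def gaussianIntegral (p : Polynomial ℝ) : ℝ := ∫ x : ℝ, p.eval x * Real.exp (-x ^ 2 / 2)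

lemma gaussianIntegral_add (p q : Polynomial ℝ) :
    gaussianIntegral (p + q) = gaussianIntegral p + gaussianIntegral q := by
  simp only [gaussianIntegral, Polynomial.eval_add, add_mul]
  exact integral_add (integrable_eval_mul_gaussian p) (integrable_eval_mul_gaussian q)

lemma gaussianIntegral_C_mul (c : ℝ) (p : Polynomial ℝ) :
    gaussianIntegral (Polynomial.C c * p) = c * gaussianIntegral p := by
  simp only [gaussianIntegral, Polynomial.eval_mul, Polynomial.eval_C, mul_assoc]
  exact integral_const_mul _ _

lemma gaussianIntegral_one : gaussianIntegral 1 = √(2 * Real.pi) := by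
  have h := integral_gaussian (1 / 2)
  simp only [gaussianIntegral, Polynomial.eval_one, one_mul]
  convert h using 3 <;> ring_nf

/-- Integration by parts against the Gaussian weight. -/
lemma gaussianIntegral_X_mul (p : Polynomial ℝ) :
    gaussianIntegral (Polynomial.X * p) = gaussianIntegral (Polynomial.derivative p) := by
  have hd : ∀ x : ℝ, HasDerivAt (fun x => p.eval x * Real.exp (-x ^ 2 / 2))
      ((Polynomial.derivative p - Polynomial.X * p).eval x * Real.exp (-x ^ 2 / 2)) x := by
    intro x
    have h1 : HasDerivAt (fun x : ℝ => -x ^ 2 / 2) (-x) x := by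
      have := ((hasDerivAt_pow 2 x).neg).div_const 2
      refine this.congr_deriv ?_
      simp; ring
    refine ((p.hasDerivAt x).mul h1.exp).congr_deriv ?_
    simp; ring
  have h := integral_eq_zero_of_hasDerivAt_of_integrable hd
    (integrable_eval_mul_gaussian _) (integrable_eval_mul_gaussian p)
  have h2 := gaussianIntegral_add (Polynomial.derivative p - Polynomial.X * p) (Polynomial.X * p)
  rw [sub_add_cancel] at h2
  change gaussianIntegral _ = 0 at h
  rw [h2, h, zero_add]

/-- The probabilists' Hermite polynomials with real coefficients. -/
def realHermite (k : ℕ) : Polynomial ℝ := (Polynomial.hermite k).map (Int.castRingHom ℝ)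

lemma realHermite_zero : realHermite 0 = 1 := by simp [realHermite]

lemma realHermite_succ (k : ℕ) :
    realHermite (k + 1) =
      Polynomial.X * realHermite k - Polynomial.derivative (realHermite k) := by
  simp [realHermite, Polynomial.hermite_succ, Polynomial.derivative_map]

lemma realHermite_monic (k : ℕ) : (realHermite k).Monic :=
  (Polynomial.hermite_monic k).map _

lemma natDegree_realHermite (k : ℕ) : (realHermite k).natDegree = k := by
  rw [realHermite, (Polynomial.hermite_monic k).natDegree_map, Polynomial.natDegree_hermite]

lemma derivative_realHermite_succ (k : ℕ) :
    Polynomial.derivative (realHermite (k + 1)) =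
      Polynomial.C ((k : ℝ) + 1) * realHermite k := by
  induction k with
  | zero => simp [realHermite_succ, realHermite_zero]
  | succ k ih =>
    rw [realHermite_succ (k + 1), Polynomial.derivative_sub, ih, Polynomial.derivative_mul, ih,
      Polynomial.derivative_C_mul]
    have h := realHermite_succ k
    have h' : Polynomial.derivative (realHermite k)
      = Polynomial.X * realHermite k - realHermite (k + 1) := by rw [h]; ring
    rw [h']
    simp only [Polynomial.derivative_X, Nat.cast_add, Nat.cast_one, Polynomial.C_add,
      Polynomial.C_1]
    ring

lemma gaussianIntegral_realHermite_mul (k : ℕ) (q : Polynomial ℝ) :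
    gaussianIntegral (realHermite k * q) = gaussianIntegral (Polynomial.derivative^[k] q) := by
  induction k generalizing q with
  | zero => simp [realHermite_zero]
  | succ k ih =>
    have h1 : Polynomial.X * (realHermite k * q)
        = realHermite (k + 1) * q + Polynomial.derivative (realHermite k) * q := by
      rw [realHermite_succ]; ring
    have h2 := gaussianIntegral_X_mul (realHermite k * q)
    rw [h1, Polynomial.derivative_mul, gaussianIntegral_add, gaussianIntegral_add, ih] at h2
    rw [Function.iterate_succ_apply]
    linarith

lemma gaussianIntegral_realHermite_mul_of_lt {j k : ℕ} (h : j < k) :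
    gaussianIntegral (realHermite k * realHermite j) = 0 := by
  rw [gaussianIntegral_realHermite_mul, Polynomial.iterate_derivative_eq_zero
    (by rwa [natDegree_realHermite])]
  simp [gaussianIntegral]

lemma gaussianIntegral_realHermite_mul_of_ne {j k : ℕ} (h : j ≠ k) :
    gaussianIntegral (realHermite j * realHermite k) = 0 := by
  rcases lt_or_gt_of_ne h with h | h
  · rw [mul_comm]; exact gaussianIntegral_realHermite_mul_of_lt h
  · exact gaussianIntegral_realHermite_mul_of_lt h

lemma gaussianIntegral_realHermite_mul_self (k : ℕ) :
    gaussianIntegral (realHermite k * realHermite k) = k.factorial * √(2 * Real.pi) := by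
  have h : Polynomial.derivative^[k] (realHermite k) = Polynomial.C (k.factorial : ℝ) * 1 := by
    induction k with
    | zero => simp [realHermite_zero]
    | succ k ih =>
      rw [Function.iterate_succ_apply, derivative_realHermite_succ,
        Polynomial.iterate_derivative_C_mul, ih, Nat.factorial_succ]
      push_cast
      simp only [Polynomial.C_mul, mul_one, Polynomial.C_add, Polynomial.C_1]
  rw [gaussianIntegral_realHermite_mul, h, gaussianIntegral_C_mul, gaussianIntegral_one]

lemma X_mul_realHermite_succ (k : ℕ) :
    Polynomial.X * realHermite (k + 1) =
      realHermite (k + 2) + Polynomial.C ((k : ℝ) + 1) * realHermite k := by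
  rw [realHermite_succ (k + 1), derivative_realHermite_succ]; ring

lemma X_sq_mul_realHermite (k : ℕ) :
    Polynomial.X ^ 2 * realHermite (k + 2) =
      realHermite (k + 4) + Polynomial.C (2 * (k : ℝ) + 5) * realHermite (k + 2)
        + Polynomial.C (((k : ℝ) + 2) * (k + 1)) * realHermite k := by
  have h1 := X_mul_realHermite_succ (k + 1)
  have h2 := X_mul_realHermite_succ k
  have h3 := X_mul_realHermite_succ (k + 2)
  have : Polynomial.X ^ 2 * realHermite (k + 2)
      = Polynomial.X * realHermite (k + 2 + 1)
        + Polynomial.C (((k + 1 : ℕ) : ℝ) + 1) * (Polynomial.X * realHermite (k + 1)) := by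
    rw [pow_two, mul_assoc, h1]; ring
  rw [this, h2, h3]
  push_cast
  simp only [Polynomial.C_add, Polynomial.C_mul, Polynomial.C_1]
  have e2 : (Polynomial.C (2 : ℝ)) = 2 := rfl
  have e5 : (Polynomial.C (5 : ℝ)) = 5 := rfl
  rw [e2, e5]
  ring

lemma gaussianIntegral_X_pow_four : gaussianIntegral (Polynomial.X ^ 4) = 3 * √(2 * Real.pi) := by
  have h1 : (Polynomial.X : Polynomial ℝ) ^ 4 = Polynomial.X * Polynomial.X ^ 3 := by ring
  have h2 : Polynomial.derivative ((Polynomial.X : Polynomial ℝ) ^ 3)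
      = Polynomial.C 3 * (Polynomial.X * Polynomial.X) := by
    rw [Polynomial.derivative_X_pow]
    norm_num [pow_two]
  rw [h1, gaussianIntegral_X_mul, h2, gaussianIntegral_C_mul, gaussianIntegral_X_mul,
    Polynomial.derivative_X, gaussianIntegral_one]

lemma gaussianIntegral_X_pow_four_mul_realHermite_add_two (k : ℕ) :
    gaussianIntegral (Polynomial.X ^ 4 * (realHermite (k + 2) * realHermite (k + 2))) =
      (6 * (k : ℝ) ^ 2 + 30 * k + 39) * ((k + 2).factorial * √(2 * Real.pi)) := by
  set α : ℝ := 2 * (k : ℝ) + 5 with hα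
  set β : ℝ := ((k : ℝ) + 2) * (k + 1) with hβ
  have h : Polynomial.X ^ 4 * (realHermite (k + 2) * realHermite (k + 2)) =
      realHermite (k + 4) * realHermite (k + 4)
      + Polynomial.C (α ^ 2) * (realHermite (k + 2) * realHermite (k + 2))
      + Polynomial.C (β ^ 2) * (realHermite k * realHermite k)
      + Polynomial.C (2 * α) * (realHermite (k + 4) * realHermite (k + 2))
      + Polynomial.C (2 * β) * (realHermite (k + 4) * realHermite k)
      + Polynomial.C (2 * α * β) * (realHermite (k + 2) * realHermite k) := by
    have h1 : Polynomial.X ^ 4 * (realHermite (k + 2) * realHermite (k + 2))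
        = (Polynomial.X ^ 2 * realHermite (k + 2)) ^ 2 := by ring
    rw [h1, X_sq_mul_realHermite, ← hα, ← hβ]
    simp only [Polynomial.C_mul, Polynomial.C_pow]
    have e2 : (Polynomial.C (2 : ℝ)) = 2 := rfl
    rw [e2]
    ring
  rw [h]
  simp only [gaussianIntegral_add, gaussianIntegral_C_mul, gaussianIntegral_realHermite_mul_self]
  rw [gaussianIntegral_realHermite_mul_of_lt (by lia : k + 2 < k + 4),
    gaussianIntegral_realHermite_mul_of_lt (by lia : k < k + 4),
    gaussianIntegral_realHermite_mul_of_lt (by lia : k < k + 2)]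
  simp only [Nat.factorial_succ, hα, hβ]
  push_cast
  ring

lemma gaussianIntegral_X_pow_four_mul_realHermite_even_le (i : ℕ) :
    gaussianIntegral (Polynomial.X ^ 4 * (realHermite (2 * i) * realHermite (2 * i))) ≤
      60 * ((i : ℝ) + 1) ^ 2 * ((2 * i).factorial * √(2 * Real.pi)) := by
  cases i with
  | zero =>
    have := Real.sqrt_nonneg (2 * Real.pi)
    simp only [mul_zero, realHermite_zero, mul_one, gaussianIntegral_X_pow_four]
    simp only [Nat.cast_zero, Nat.factorial_zero, Nat.cast_one]
    linarith
  | succ i =>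
    rw [show 2 * (i + 1) = 2 * i + 2 by ring,
      gaussianIntegral_X_pow_four_mul_realHermite_add_two]
    refine mul_le_mul_of_nonneg_right ?_ (by positivity)
    push_cast
    nlinarith [i.cast_nonneg (α := ℝ)]

/-- The polynomial `q` of degree `i` with `q (x²) = He_{2i} (x)`. -/
def evenHermite (i : ℕ) : Polynomial ℝ := Polynomial.contract 2 (realHermite (2 * i))

lemma expand_evenHermite (i : ℕ) :
    Polynomial.expand ℝ 2 (evenHermite i) = realHermite (2 * i) := by
  ext n
  rw [Polynomial.coeff_expand (by norm_num), evenHermite]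
  split_ifs with h
  · rw [Polynomial.coeff_contract (by norm_num), Nat.div_mul_cancel h]
  · rw [realHermite, Polynomial.coeff_map, Polynomial.coeff_hermite_of_odd_add, map_zero]
    rw [Nat.odd_add', Nat.odd_iff]
    exact ⟨fun _ => even_two_mul i, fun _ => by lia⟩

lemma evenHermite_eval_sq (i : ℕ) (x : ℝ) :
    (evenHermite i).eval (x ^ 2) = (realHermite (2 * i)).eval x := by
  rw [← expand_evenHermite, Polynomial.expand_eval]

lemma natDegree_evenHermite (i : ℕ) : (evenHermite i).natDegree = i := by
  have h := congrArg Polynomial.natDegree (expand_evenHermite i)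
  rw [Polynomial.natDegree_expand, natDegree_realHermite] at h
  lia

lemma evenHermite_monic (i : ℕ) : (evenHermite i).Monic := by
  rw [← Polynomial.monic_expand_iff (p := 2) (by norm_num), expand_evenHermite]
  exact realHermite_monic _

lemma VdM_sq_eq_det_vandermonde_sq (m : ℕ) (x : Fin m → ℝ) :
    VdM m x ^ 2 = (Matrix.vandermonde fun i => x i ^ 2).det ^ 2 := by
  rw [Matrix.det_vandermonde, VdM, ← Finset.prod_pow,
    Finset.prod_filter, Fintype.prod_prod_type, ← Finset.prod_pow]
  refine Finset.prod_congr rfl fun i _ => ?_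
  rw [← Finset.prod_pow, ← Finset.prod_filter]
  refine Finset.prod_congr ?_ fun j _ => by ring
  ext j
  simp

lemma VdM_sq_eq_det_sq (m : ℕ) (x : Fin m → ℝ) :
    VdM m x ^ 2 =
      (Matrix.of fun i j : Fin m => (realHermite (2 * i)).eval (x j)).det ^ 2 := by
  have h1 := Matrix.det_eval_matrixOfPolynomials_eq_det_vandermonde (fun i => x i ^ 2)
    (fun i : Fin m => evenHermite i) (fun i => natDegree_evenHermite i)
    (fun i => evenHermite_monic i)
  have h2 : (Matrix.of fun i j : Fin m => (realHermite (2 * i)).eval (x j))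
      = (Matrix.of fun i j : Fin m => (evenHermite j).eval (x i ^ 2)).transpose := by
    ext i j
    simp [evenHermite_eval_sq]
  rw [h2, Matrix.det_transpose, ← h1, VdM_sq_eq_det_vandermonde_sq]

lemma VdM_sq_mul_prod_eq_sum (m : ℕ) (P : Fin m → Polynomial ℝ) (x : Fin m → ℝ) :
    VdM m x ^ 2 * (∏ j, (P j).eval (x j)) * Real.exp (-(∑ j, x j ^ 2) / 2) =
      ∑ σ : Equiv.Perm (Fin m), ∑ τ : Equiv.Perm (Fin m),
        ((Equiv.Perm.sign σ : ℤ) : ℝ) * ((Equiv.Perm.sign τ : ℤ) : ℝ) *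
        ∏ j, ((P j * (realHermite (2 * σ j) * realHermite (2 * τ j))).eval (x j)
          * Real.exp (-x j ^ 2 / 2)) := by
  have hexp : Real.exp (-(∑ j, x j ^ 2) / 2) = ∏ j, Real.exp (-x j ^ 2 / 2) := by
    rw [← Real.exp_sum, ← Finset.sum_neg_distrib, Finset.sum_div]
  rw [VdM_sq_eq_det_sq, Matrix.det_apply', pow_two,
    Finset.sum_mul_sum, mul_assoc, Finset.sum_mul, hexp]
  refine Finset.sum_congr rfl fun σ _ => ?_
  rw [Finset.sum_mul]
  refine Finset.sum_congr rfl fun τ _ => ?_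
  simp only [Matrix.of_apply, Polynomial.eval_mul,
    Finset.prod_mul_distrib]
  ring

/-- The integrand `Δ(x)² ∏ P_j(x_j) exp(-|x|²/2)` is integrable. -/
lemma integrable_VdM_sq_mul_prod (m : ℕ) (P : Fin m → Polynomial ℝ) :
    Integrable fun x : Fin m → ℝ =>
      VdM m x ^ 2 * (∏ j, (P j).eval (x j)) * Real.exp (-(∑ j, x j ^ 2) / 2) := by
  simp only [VdM_sq_mul_prod_eq_sum]
  refine integrable_finsetSum _ fun σ _ => integrable_finsetSum _ fun τ _ => ?_
  refine Integrable.const_mul ?_ _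
  exact Integrable.fintype_prod fun j => integrable_eval_mul_gaussian _

/-- Andréief's identity for the polynomial ensemble. -/
lemma integral_VdM_sq_mul_prod (m : ℕ) (P : Fin m → Polynomial ℝ) :
    ∫ x : Fin m → ℝ, VdM m x ^ 2 * (∏ j, (P j).eval (x j)) * Real.exp (-(∑ j, x j ^ 2) / 2) =
      ∑ σ : Equiv.Perm (Fin m), ∑ τ : Equiv.Perm (Fin m),
        ((Equiv.Perm.sign σ : ℤ) : ℝ) * ((Equiv.Perm.sign τ : ℤ) : ℝ) *
        ∏ j, gaussianIntegral (P j * (realHermite (2 * σ j) * realHermite (2 * τ j))) := by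
  simp only [VdM_sq_mul_prod_eq_sum]
  have hint : ∀ σ τ : Equiv.Perm (Fin m), Integrable fun x : Fin m → ℝ =>
      ((Equiv.Perm.sign σ : ℤ) : ℝ) * ((Equiv.Perm.sign τ : ℤ) : ℝ) *
        ∏ j, ((P j * (realHermite (2 * σ j) * realHermite (2 * τ j))).eval (x j)
          * Real.exp (-x j ^ 2 / 2)) := fun σ τ =>
    (Integrable.fintype_prod fun j => integrable_eval_mul_gaussian _).const_mul _
  rw [integral_finsetSum _ fun σ _ => integrable_finsetSum _ fun τ _ => hint σ τ]
  refine Finset.sum_congr rfl fun σ _ => ?_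
  rw [integral_finsetSum _ fun τ _ => hint σ τ]
  refine Finset.sum_congr rfl fun τ _ => ?_
  rw [integral_const_mul, integral_fintype_prod_volume_eq_prod (fun j t =>
    (P j * (realHermite (2 * σ j) * realHermite (2 * τ j))).eval t * Real.exp (-t ^ 2 / 2))]
  rfl

/-- If all but one of the polynomial weights are trivial, only the diagonal survives. -/
lemma integral_VdM_sq_mul_prod_eq_diagonal (m : ℕ) (P : Fin m → Polynomial ℝ)
    (hP : ∀ i j, P i ≠ 1 → P j ≠ 1 → i = j) :
    ∫ x : Fin m → ℝ, VdM m x ^ 2 * (∏ j, (P j).eval (x j)) * Real.exp (-(∑ j, x j ^ 2) / 2) =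
      ∑ σ : Equiv.Perm (Fin m),
        ∏ j, gaussianIntegral (P j * (realHermite (2 * σ j) * realHermite (2 * σ j))) := by
  rw [integral_VdM_sq_mul_prod]
  refine Finset.sum_congr rfl fun σ _ => ?_
  rw [Finset.sum_eq_single σ]
  · have : ((Equiv.Perm.sign σ : ℤ) : ℝ) * ((Equiv.Perm.sign σ : ℤ) : ℝ) = 1 := by
      rw [← Int.cast_mul, ← Units.val_mul, Int.units_mul_self]; simp
    rw [this, one_mul]
  · intro τ _ hτ
    obtain ⟨i, hi, hPi⟩ : ∃ i, σ i ≠ τ i ∧ P i = 1 := by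
      by_contra! hcon
      obtain ⟨i, hi⟩ : ∃ i, σ i ≠ τ i := by
        by_contra! h
        exact hτ (Equiv.ext fun i => (h i).symm)
      have hj : σ (σ.symm (τ i)) ≠ τ (σ.symm (τ i)) := by
        intro h
        rw [Equiv.apply_symm_apply] at h
        have := τ.injective h
        rw [Equiv.eq_symm_apply] at this
        exact hi this
      have := hP _ _ (hcon i hi) (hcon _ hj)
      rw [Equiv.eq_symm_apply] at this
      exact hi this
    rw [Finset.prod_eq_zero (Finset.mem_univ i), mul_zero]
    rw [hPi, one_mul]
    refine gaussianIntegral_realHermite_mul_of_ne fun h => hi ?_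
    exact Fin.ext (by lia)
  · simp

/-- The unnormalized density `Δ(x)² exp(-|x|²/2)`. -/
def ensembleDensity (m : ℕ) (x : Fin m → ℝ) : ℝ :=
  VdM m x ^ 2 * Real.exp (-(∑ j, x j ^ 2) / 2)

lemma ensembleDensity_nonneg (m : ℕ) (x : Fin m → ℝ) : 0 ≤ ensembleDensity m x := by
  unfold ensembleDensity; positivity

lemma integrable_ensembleDensity (m : ℕ) : Integrable (ensembleDensity m) := by
  simpa [ensembleDensity] using! integrable_VdM_sq_mul_prod m fun _ => 1

/-- The total mass of the ensemble on the whole space. -/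
def totalMass (m : ℕ) : ℝ :=
  m.factorial * ∏ j : Fin m, (((2 * (j : ℕ)).factorial : ℝ) * √(2 * Real.pi))

lemma integral_ensembleDensity (m : ℕ) : ∫ x, ensembleDensity m x = totalMass m := by
  have h := integral_VdM_sq_mul_prod_eq_diagonal m (fun _ => 1) (by simp)
  simp only [Polynomial.eval_one, Finset.prod_const_one, mul_one, one_mul,
    gaussianIntegral_realHermite_mul_self] at h
  unfold ensembleDensity
  rw [h, totalMass, Finset.sum_congr rfl fun σ _ => Equiv.prod_comp σ fun j : Fin m =>
    ((2 * (j : ℕ)).factorial : ℝ) * √(2 * Real.pi)]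
  simp [Fintype.card_perm]

lemma prod_eval_ite_X_pow_four {m : ℕ} (k : Fin m) (x : Fin m → ℝ) :
    ∏ j, ((if j = k then Polynomial.X ^ 4 else 1 : Polynomial ℝ)).eval (x j) = x k ^ 4 := by
  rw [Finset.prod_eq_single k] <;> simp +contextual

lemma integrable_pow_four_mul_ensembleDensity {m : ℕ} (k : Fin m) :
    Integrable fun x => x k ^ 4 * ensembleDensity m x := by
  have h := integrable_VdM_sq_mul_prod m fun j => if j = k then Polynomial.X ^ 4 else 1
  simp only [prod_eval_ite_X_pow_four] at h
  refine h.congr (Filter.Eventually.of_forall fun x => ?_)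
  simp only [ensembleDensity]
  ring

lemma integral_pow_four_mul_ensembleDensity_le {m : ℕ} (k : Fin m) :
    ∫ x, x k ^ 4 * ensembleDensity m x ≤ 60 * (m : ℝ) ^ 2 * totalMass m := by
  have h := integral_VdM_sq_mul_prod_eq_diagonal m
    (fun j => if j = k then Polynomial.X ^ 4 else 1) (by
      intro i j hi hj
      simp only [ne_eq, ite_eq_right_iff, not_forall, exists_prop] at hi hj
      rw [hi.1, hj.1])
  simp only [prod_eval_ite_X_pow_four] at h
  have h' : ∫ x, x k ^ 4 * ensembleDensity m x = _ :=
    (integral_congr_ae (Filter.Eventually.of_forall fun x => by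
      simp only [ensembleDensity]; ring)).trans h
  rw [h']
  have hσ : ∀ σ : Equiv.Perm (Fin m), ∏ j, gaussianIntegral
      ((if j = k then Polynomial.X ^ 4 else 1) *
        (realHermite (2 * σ j) * realHermite (2 * σ j))) ≤
      60 * (m : ℝ) ^ 2 * ∏ j : Fin m, (((2 * (j : ℕ)).factorial : ℝ) * √(2 * Real.pi)) := by
    intro σ
    rw [← Equiv.prod_comp σ fun j : Fin m => ((2 * (j : ℕ)).factorial : ℝ) * √(2 * Real.pi),
      ← Finset.mul_prod_erase _ _ (Finset.mem_univ k),
      ← Finset.mul_prod_erase (a := k) _ (fun j => _ * √(2 * Real.pi)) (Finset.mem_univ k)]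
    have hprod : ∏ j ∈ Finset.univ.erase k, gaussianIntegral
        ((if j = k then Polynomial.X ^ 4 else 1) *
          (realHermite (2 * σ j) * realHermite (2 * σ j))) =
        ∏ j ∈ Finset.univ.erase k, (((2 * (σ j : ℕ)).factorial : ℝ) * √(2 * Real.pi)) := by
      refine Finset.prod_congr rfl fun j hj => ?_
      rw [if_neg (Finset.ne_of_mem_erase hj), one_mul, gaussianIntegral_realHermite_mul_self]
    rw [hprod, ← mul_assoc (60 * (m : ℝ) ^ 2)]
    refine mul_le_mul_of_nonneg_right ?_ (Finset.prod_nonneg fun _ _ => by positivity)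
    rw [if_pos rfl]
    refine (gaussianIntegral_X_pow_four_mul_realHermite_even_le _).trans ?_
    have : ((σ k : ℕ) : ℝ) + 1 ≤ m := by exact_mod_cast (σ k).isLt
    gcongr
  refine (Finset.sum_le_sum fun σ _ => hσ σ).trans_eq ?_
  rw [Finset.sum_const, Finset.card_univ, Fintype.card_perm, Fintype.card_fin, totalMass,
    nsmul_eq_mul]
  ring

lemma card_filter_fst_lt_snd_mul_two (m : ℕ) :
    (Finset.univ.filter fun p : Fin m × Fin m => p.1 < p.2).card * 2 = m * (m - 1) := by
  have h : (Finset.univ.filter fun p : Fin m × Fin m => p.1 < p.2).card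
      = ∑ i : Fin m, (m - 1 - (i : ℕ)) := by
    rw [Finset.card_filter, Fintype.sum_prod_type]
    refine Finset.sum_congr rfl fun i _ => ?_
    rw [← Finset.card_filter, ← Fin.card_Ioi]
    congr 1
    ext j
    simp
  rw [h, Fin.sum_univ_eq_sum_range fun i => m - 1 - i, Finset.sum_range_reflect (fun i => i),
    Finset.sum_range_id_mul_two]

lemma two_mul_choose_two_eq (m : ℕ) : (2 * m).choose 2 = 2 * (m * (m - 1)) + m := by
  rw [Nat.choose_two_right, mul_assoc, Nat.mul_div_cancel_left _ (by norm_num)]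
  cases m with
  | zero => rfl
  | succ m =>
    rw [show 2 * (m + 1) - 1 = 2 * m + 1 by lia, Nat.add_sub_cancel]
    ring

lemma VdM_smul_sq (m : ℕ) (t : ℝ) (x : Fin m → ℝ) :
    VdM m (t • x) ^ 2 = t ^ (2 * (m * (m - 1))) * VdM m x ^ 2 := by
  have h : VdM m (t • x) = (t ^ 2) ^
      (Finset.univ.filter fun p : Fin m × Fin m => p.1 < p.2).card * VdM m x := by
    rw [VdM, VdM, ← Finset.prod_const, ← Finset.prod_mul_distrib]
    refine Finset.prod_congr rfl fun p _ => ?_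
    simp only [Pi.smul_apply, smul_eq_mul]
    ring
  rw [h, mul_pow, ← pow_mul, ← pow_mul, ← card_filter_fst_lt_snd_mul_two]

lemma sum_smul_sq {m : ℕ} (t : ℝ) (x : Fin m → ℝ) :
    ∑ j, (t • x) j ^ 2 = t ^ 2 * ∑ j, x j ^ 2 := by
  simp only [Pi.smul_apply, smul_eq_mul, mul_pow, Finset.mul_sum]

lemma ensembleDensity_smul (m : ℕ) (t : ℝ) (x : Fin m → ℝ) :
    ensembleDensity m (t • x) = t ^ (2 * (m * (m - 1))) *
      (Real.exp ((1 - t ^ 2) * (∑ j, x j ^ 2) / 2) * ensembleDensity m x) := by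
  rw [ensembleDensity, ensembleDensity, VdM_smul_sq, sum_smul_sq,
    mul_left_comm (Real.exp _), ← Real.exp_add]
  ring_nf

lemma integral_eq_pow_mul_integral_comp_smul {m : ℕ} {t : ℝ} (ht : 0 < t)
    (F : (Fin m → ℝ) → ℝ) : ∫ x, F x = t ^ m * ∫ x, F (t • x) := by
  rw [Measure.integral_comp_smul, Module.finrank_fin_fun, abs_of_pos (by positivity),
    smul_eq_mul, mul_inv_cancel_left₀ (by positivity)]

lemma integrable_exp_mul_ensembleDensity (m : ℕ) {t : ℝ} (ht : 0 < t) :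
    Integrable fun x : Fin m → ℝ =>
      Real.exp ((1 - t ^ 2) * (∑ j, x j ^ 2) / 2) * ensembleDensity m x := by
  have h := ((integrable_ensembleDensity m).comp_smul ht.ne').const_mul
    (t ^ (2 * (m * (m - 1))))⁻¹
  refine h.congr (Filter.Eventually.of_forall fun x => ?_)
  simp only [ensembleDensity_smul]
  rw [inv_mul_cancel_left₀ (by positivity)]

/-- The Laplace transform of `|x|²` under the ensemble. -/
lemma integral_exp_mul_ensembleDensity (m : ℕ) {t : ℝ} (ht : 0 < t) :
    ∫ x : Fin m → ℝ, Real.exp ((1 - t ^ 2) * (∑ j, x j ^ 2) / 2) * ensembleDensity m x =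
      t⁻¹ ^ (2 * m).choose 2 * totalMass m := by
  have h := integral_eq_pow_mul_integral_comp_smul ht (ensembleDensity m)
  simp only [ensembleDensity_smul] at h
  rw [integral_const_mul, integral_ensembleDensity] at h
  rw [h, two_mul_choose_two_eq, inv_pow, pow_add]
  field_simp

/-- The base of the exponential concentration bound for `|x|²` at `r² N`. -/
def chernoffBase (r : ℝ) : ℝ := r * Real.exp ((1 - r ^ 2) / 2)

lemma chernoffBase_nonneg {r : ℝ} (hr : 0 < r) : 0 ≤ chernoffBase r := by
  unfold chernoffBase; positivity

lemma chernoffBase_lt_one {r : ℝ} (hr : 0 < r) (hr1 : r ≠ 1) : chernoffBase r < 1 := by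
  have hne : r ^ 2 - 1 ≠ 0 := by
    intro h
    rcases mul_eq_zero.mp (show (r - 1) * (r + 1) = 0 by linarith) with h | h
    · exact hr1 (by linarith)
    · linarith
  have h := Real.add_one_lt_exp hne
  have h2 : chernoffBase r ^ 2 < 1 := by
    have h3 : chernoffBase r ^ 2 = r ^ 2 * Real.exp (-(r ^ 2 - 1)) := by
      rw [chernoffBase, mul_pow, ← Real.exp_nat_mul]
      congr 2
      push_cast
      ring
    rw [h3, Real.exp_neg, ← div_eq_mul_inv, div_lt_one (Real.exp_pos _)]
    linarith
  nlinarith [chernoffBase_nonneg hr]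

/-- The exponential tilt that dominates the indicator of `|x|²` lying beyond `r² N`. -/
def chernoffTilt (m : ℕ) (r : ℝ) (x : Fin m → ℝ) : ℝ :=
  Real.exp ((1 - r⁻¹ ^ 2) * (∑ j, x j ^ 2 - r ^ 2 * ((2 * m).choose 2 : ℝ)) / 2)

lemma chernoffTilt_mul_ensembleDensity (m : ℕ) {r : ℝ} (hr : 0 < r) (x : Fin m → ℝ) :
    chernoffTilt m r x * ensembleDensity m x =
      Real.exp ((1 - r ^ 2) / 2) ^ (2 * m).choose 2 *
        (Real.exp ((1 - r⁻¹ ^ 2) * (∑ j, x j ^ 2) / 2) * ensembleDensity m x) := by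
  rw [chernoffTilt, ← mul_assoc, ← Real.exp_nat_mul, ← Real.exp_add]
  congr 2
  field_simp
  ring

lemma integrable_chernoffTilt_mul (m : ℕ) {r : ℝ} (hr : 0 < r) :
    Integrable fun x => chernoffTilt m r x * ensembleDensity m x := by
  simp only [chernoffTilt_mul_ensembleDensity m hr]
  exact (integrable_exp_mul_ensembleDensity m (inv_pos.mpr hr)).const_mul _

lemma integral_chernoffTilt_mul (m : ℕ) {r : ℝ} (hr : 0 < r) :
    ∫ x, chernoffTilt m r x * ensembleDensity m x =
      chernoffBase r ^ (2 * m).choose 2 * totalMass m := by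
  simp only [chernoffTilt_mul_ensembleDensity m hr]
  rw [integral_const_mul, integral_exp_mul_ensembleDensity m (inv_pos.mpr hr), inv_inv,
    chernoffBase, mul_pow]
  ring

/-- The symmetric set `a N < |x|² < b N`, `x_i² ≤ δ N`, where `N = C(2m, 2)`. -/
def shellSet (m : ℕ) (a b δ : ℝ) : Set (Fin m → ℝ) :=
  {x | (a * ((2 * m).choose 2 : ℝ) < ∑ j, x j ^ 2 ∧
    ∑ j, x j ^ 2 < b * ((2 * m).choose 2 : ℝ)) ∧ ∀ i, x i ^ 2 ≤ δ * ((2 * m).choose 2 : ℝ)}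

lemma measurableSet_shellSet (m : ℕ) (a b δ : ℝ) : MeasurableSet (shellSet m a b δ) := by
  have hs : Measurable fun x : Fin m → ℝ => ∑ j, x j ^ 2 := by fun_prop
  have h : shellSet m a b δ = ({x | a * ((2 * m).choose 2 : ℝ) < ∑ j, x j ^ 2} ∩
      {x | ∑ j, x j ^ 2 < b * ((2 * m).choose 2 : ℝ)}) ∩
      ⋂ i, {x | x i ^ 2 ≤ δ * ((2 * m).choose 2 : ℝ)} := by
    ext x
    simp [shellSet]
  rw [h]
  exact ((measurableSet_lt measurable_const hs).inter (measurableSet_lt hs measurable_const)).inter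
    (MeasurableSet.iInter fun i => measurableSet_le (by fun_prop) measurable_const)

/-- The ensemble concentrates on the shell. -/
lemma totalMass_mul_le_setIntegral_shellSet {m : ℕ} (hm : 0 < m) {r s δ : ℝ} (hr : 0 < r)
    (hr1 : r < 1) (hs : 1 < s) (hδ : 0 < δ) :
    (1 - chernoffBase r ^ (2 * m).choose 2 - chernoffBase s ^ (2 * m).choose 2
      - 60 * (m : ℝ) ^ 3 / (δ * ((2 * m).choose 2 : ℝ)) ^ 2) * totalMass m ≤
      ∫ x in shellSet m (r ^ 2) (s ^ 2) δ, ensembleDensity m x := by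
  have hN : 0 < ((2 * m).choose 2 : ℝ) := by
    exact_mod_cast Nat.choose_pos (by lia)
  set N : ℝ := ((2 * m).choose 2 : ℝ) with hNdef
  have hint1 := integrable_chernoffTilt_mul m hr
  have hint2 := integrable_chernoffTilt_mul m (zero_lt_one.trans hs)
  have hint3 : Integrable fun x : Fin m → ℝ =>
      ∑ k, ((δ * N) ^ 2)⁻¹ * (x k ^ 4 * ensembleDensity m x) :=
    integrable_finsetSum _ fun k _ => (integrable_pow_four_mul_ensembleDensity k).const_mul _
  have hsub1 : Integrable fun x =>
      ensembleDensity m x - chernoffTilt m r x * ensembleDensity m x :=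
    (integrable_ensembleDensity m).sub hint1
  have hsub2 : Integrable fun x =>
      ensembleDensity m x - chernoffTilt m r x * ensembleDensity m x
        - chernoffTilt m s x * ensembleDensity m x := hsub1.sub hint2
  have h3 : ∫ x : Fin m → ℝ, ∑ k, ((δ * N) ^ 2)⁻¹ * (x k ^ 4 * ensembleDensity m x) ≤
      60 * (m : ℝ) ^ 3 / (δ * N) ^ 2 * totalMass m := by
    rw [integral_finsetSum _ fun k _ =>
      (integrable_pow_four_mul_ensembleDensity k).const_mul _]
    calc _ ≤ ∑ k : Fin m, ((δ * N) ^ 2)⁻¹ * (60 * (m : ℝ) ^ 2 * totalMass m) := by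
          refine Finset.sum_le_sum fun k _ => ?_
          rw [integral_const_mul]
          exact mul_le_mul_of_nonneg_left (integral_pow_four_mul_ensembleDensity_le k)
            (by positivity)
      _ = _ := by
          rw [Finset.sum_const, Finset.card_univ, Fintype.card_fin, nsmul_eq_mul]
          ring
  rw [← integral_indicator (measurableSet_shellSet _ _ _ _)]
  calc _ ≤ ∫ x : Fin m → ℝ, (ensembleDensity m x - chernoffTilt m r x * ensembleDensity m x
        - chernoffTilt m s x * ensembleDensity m x
        - ∑ k, ((δ * N) ^ 2)⁻¹ * (x k ^ 4 * ensembleDensity m x)) := by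
        rw [integral_sub hsub2 hint3, integral_sub hsub1 hint2,
          integral_sub (integrable_ensembleDensity m) hint1, integral_ensembleDensity,
          integral_chernoffTilt_mul m hr, integral_chernoffTilt_mul m (zero_lt_one.trans hs)]
        linarith
    _ ≤ _ := by
        refine integral_mono (hsub2.sub hint3)
          ((integrable_ensembleDensity m).indicator (measurableSet_shellSet _ _ _ _)) fun x => ?_
        have hd := ensembleDensity_nonneg m x
        have ht1 : 0 ≤ chernoffTilt m r x * ensembleDensity m x :=
          mul_nonneg (Real.exp_pos _).le hd
        have ht2 : 0 ≤ chernoffTilt m s x * ensembleDensity m x :=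
          mul_nonneg (Real.exp_pos _).le hd
        have hk : ∀ k ∈ Finset.univ, 0 ≤ ((δ * N) ^ 2)⁻¹ * (x k ^ 4 * ensembleDensity m x) :=
          fun k _ => by positivity
        have ht3 := Finset.sum_nonneg hk
        by_cases hx : x ∈ shellSet m (r ^ 2) (s ^ 2) δ
        · rw [Set.indicator_of_mem hx]
          linarith
        rw [Set.indicator_of_notMem hx]
        suffices h : 1 ≤ chernoffTilt m r x ∨ 1 ≤ chernoffTilt m s x ∨
            ∃ k, 1 ≤ ((δ * N) ^ 2)⁻¹ * x k ^ 4 by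
          rcases h with h | h | ⟨k, h⟩
          · linarith [le_mul_of_one_le_left hd h]
          · linarith [le_mul_of_one_le_left hd h]
          · have h4 := Finset.single_le_sum hk (Finset.mem_univ k)
            rw [← mul_assoc] at h4
            linarith [le_mul_of_one_le_left hd h]
        by_contra! hcon
        obtain ⟨hc1, hc2, hc3⟩ := hcon
        refine hx ⟨⟨?_, ?_⟩, fun i => ?_⟩
        · by_contra! hle
          refine hc1.not_ge (Real.one_le_exp (div_nonneg ?_ zero_le_two))
          refine mul_nonneg_of_nonpos_of_nonpos ?_ (by linarith)
          have : 1 ≤ r⁻¹ ^ 2 := one_le_pow₀ ((one_le_inv₀ hr).mpr hr1.le)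
          linarith
        · by_contra! hle
          refine hc2.not_ge (Real.one_le_exp (div_nonneg ?_ zero_le_two))
          refine mul_nonneg ?_ (by linarith)
          have : s⁻¹ ^ 2 ≤ 1 := pow_le_one₀ (by positivity) (inv_le_one_of_one_le₀ hs.le)
          linarith
        · have h := hc3 i
          rw [inv_mul_lt_one₀ (by positivity), show x i ^ 4 = (x i ^ 2) ^ 2 by ring] at h
          exact (lt_of_pow_lt_pow_left₀ 2 (by positivity) h).le

/-- Effect of a contraction on the mass of a shell. -/
lemma pow_mul_setIntegral_shellSet_le (m : ℕ) {t a b δ : ℝ} (ht : 0 < t) (ht1 : t ≤ 1) :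
    (t * Real.exp ((1 - t ^ 2) * a / 2)) ^ (2 * m).choose 2 *
        ∫ x in shellSet m a b δ, ensembleDensity m x ≤
      ∫ x in shellSet m (t ^ 2 * a) (t ^ 2 * b) (t ^ 2 * δ), ensembleDensity m x := by
  have hmeas := measurableSet_shellSet m (t ^ 2 * a) (t ^ 2 * b) (t ^ 2 * δ)
  rw [← integral_indicator hmeas, ← integral_indicator (measurableSet_shellSet _ _ _ _),
    integral_eq_pow_mul_integral_comp_smul ht
      ((shellSet m (t ^ 2 * a) (t ^ 2 * b) (t ^ 2 * δ)).indicator _), mul_pow,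
    two_mul_choose_two_eq m, pow_add t,
    mul_comm (t ^ _) (t ^ m), mul_assoc, mul_assoc (t ^ m)]
  refine mul_le_mul_of_nonneg_left ?_ (by positivity)
  rw [← integral_const_mul, ← integral_const_mul, ← two_mul_choose_two_eq m]
  refine integral_mono
    ((((integrable_ensembleDensity m).indicator (measurableSet_shellSet _ _ _ _)).const_mul
      _).const_mul _)
    (((integrable_ensembleDensity m).indicator hmeas).comp_smul ht.ne') fun x => ?_
  by_cases hx : x ∈ shellSet m a b δ
  · have hx' : t • x ∈ shellSet m (t ^ 2 * a) (t ^ 2 * b) (t ^ 2 * δ) := by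
      obtain ⟨⟨h1, h2⟩, h3⟩ := hx
      have ht2 : 0 < t ^ 2 := by positivity
      refine ⟨⟨?_, ?_⟩, fun i => ?_⟩
      · rw [sum_smul_sq, mul_assoc]; exact mul_lt_mul_of_pos_left h1 ht2
      · rw [sum_smul_sq, mul_assoc]; exact mul_lt_mul_of_pos_left h2 ht2
      · rw [Pi.smul_apply, smul_eq_mul, mul_pow, mul_assoc]
        exact mul_le_mul_of_nonneg_left (h3 i) ht2.le
    simp only [Set.indicator_of_mem hx, Set.indicator_of_mem hx', ensembleDensity_smul]
    refine mul_le_mul_of_nonneg_left ?_ (by positivity)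
    refine mul_le_mul_of_nonneg_right ?_ (ensembleDensity_nonneg m x)
    rw [← Real.exp_nat_mul, Real.exp_le_exp]
    have ht2 : 0 ≤ 1 - t ^ 2 := by nlinarith
    have := mul_le_mul_of_nonneg_left hx.1.1.le ht2
    linarith
  · simp only [Set.indicator_of_notMem hx, mul_zero]
    exact Set.indicator_nonneg (fun y _ => ensembleDensity_nonneg m y) _

/-- The action of a permutation followed by sign changes. -/
def signedPerm {m : ℕ} (ε : Fin m → ℤˣ) (σ : Equiv.Perm (Fin m)) (x : Fin m → ℝ) : Fin m → ℝ :=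
  fun i => ((ε i : ℤ) : ℝ) * x (σ i)

lemma signedPerm_apply_sq {m : ℕ} (ε : Fin m → ℤˣ) (σ : Equiv.Perm (Fin m)) (x : Fin m → ℝ)
    (i : Fin m) : signedPerm ε σ x i ^ 2 = x (σ i) ^ 2 := by
  rcases Int.units_eq_one_or (ε i) with h | h <;> simp [signedPerm, h]

lemma sum_signedPerm_sq {m : ℕ} (ε : Fin m → ℤˣ) (σ : Equiv.Perm (Fin m)) (x : Fin m → ℝ) :
    ∑ i, signedPerm ε σ x i ^ 2 = ∑ i, x i ^ 2 := by
  simp only [signedPerm_apply_sq]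
  exact Equiv.sum_comp σ fun i => x i ^ 2

lemma measurePreserving_signedPerm {m : ℕ} (ε : Fin m → ℤˣ) (σ : Equiv.Perm (Fin m)) :
    MeasurePreserving (signedPerm ε σ : (Fin m → ℝ) → Fin m → ℝ) := by
  have h1 : MeasurePreserving (fun (x : Fin m → ℝ) i => ((ε i : ℤ) : ℝ) * x i) := by
    refine volume_preserving_pi fun i => ?_
    rcases Int.units_eq_one_or (ε i) with h | h
    · have e : (HMul.hMul ((ε i : ℤ) : ℝ) : ℝ → ℝ) = id := by ext t; simp [h]
      rw [e]
      exact MeasurePreserving.id _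
    · have e : (HMul.hMul ((ε i : ℤ) : ℝ) : ℝ → ℝ) = Neg.neg := by ext t; simp [h]
      rw [e]
      exact Measure.measurePreserving_neg _
  have h2 := volume_measurePreserving_piCongrLeft (fun _ : Fin m => ℝ) σ.symm
  have h3 : (signedPerm ε σ : (Fin m → ℝ) → Fin m → ℝ) =
      (fun (x : Fin m → ℝ) i => ((ε i : ℤ) : ℝ) * x i) ∘
        MeasurableEquiv.piCongrLeft (fun _ : Fin m => ℝ) σ.symm := by
    ext x i
    simp only [signedPerm, Function.comp_apply, MeasurableEquiv.coe_piCongrLeft]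
    rw [Equiv.piCongrLeft_apply]
    simp
  rw [h3]
  exact h1.comp h2

lemma ensembleDensity_signedPerm {m : ℕ} (ε : Fin m → ℤˣ) (σ : Equiv.Perm (Fin m))
    (x : Fin m → ℝ) : ensembleDensity m (signedPerm ε σ x) = ensembleDensity m x := by
  have h : (Matrix.vandermonde fun i => x (σ i) ^ 2)
      = (Matrix.vandermonde fun i => x i ^ 2).submatrix σ id := rfl
  have hs : (((Equiv.Perm.sign σ : ℤˣ) : ℤ) : ℝ) ^ 2 = 1 := by
    rcases Int.units_eq_one_or (Equiv.Perm.sign σ) with h | h <;> simp [h]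
  rw [ensembleDensity, sum_signedPerm_sq, VdM_sq_eq_det_vandermonde_sq]
  simp only [signedPerm_apply_sq]
  rw [ensembleDensity, VdM_sq_eq_det_vandermonde_sq, h, Matrix.det_permute, mul_pow, hs, one_mul]

lemma ensembleDensity_eq_zero {m : ℕ} {x : Fin m → ℝ} {i j : Fin m} (hij : i ≠ j)
    (h : x i ^ 2 = x j ^ 2) : ensembleDensity m x = 0 := by
  have : (Matrix.vandermonde fun i => x i ^ 2).det = 0 :=
    Matrix.det_vandermonde_eq_zero_iff.mpr ⟨i, j, h, hij⟩
  rw [ensembleDensity, VdM_sq_eq_det_vandermonde_sq, this]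
  simp

/-- Off the coordinate hyperplanes and the walls, every point is moved into the chamber by some
signed permutation. -/
lemma exists_signedPerm_mem_SigmaN {m : ℕ} {x : Fin m → ℝ} (h0 : ∀ i, x i ≠ 0)
    (hne : ∀ i j, i ≠ j → x i ^ 2 ≠ x j ^ 2) : ∃ ε σ, signedPerm ε σ x ∈ SigmaN m := by
  set σ := Tuple.sort fun i => -|x i| with hσ
  have hmono : Monotone ((fun i => -|x i|) ∘ σ) := Tuple.monotone_sort _
  refine ⟨fun i => if 0 < x (σ i) then 1 else -1, σ, ?_⟩
  have habs : ∀ i, signedPerm (fun i => if 0 < x (σ i) then 1 else -1) σ x i = |x (σ i)| := by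
    intro i
    by_cases h : 0 < x (σ i)
    · simp [signedPerm, h, abs_of_pos h]
    · simp [signedPerm, h, abs_of_nonpos (not_lt.mp h)]
  refine ⟨fun i j hij => ?_, fun i => ?_⟩
  · rw [habs, habs]
    have hle := hmono hij.le
    simp only [Function.comp_apply, neg_le_neg_iff] at hle
    refine lt_of_le_of_ne hle fun h => ?_
    exact hne _ _ (σ.injective.ne hij.ne) ((sq_eq_sq_iff_abs_eq_abs _ _).mpr h.symm)
  · rw [habs]; exact abs_pos.mpr (h0 _)

lemma measurableSet_SigmaN (m : ℕ) : MeasurableSet (SigmaN m) := by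
  have h : SigmaN m = (⋂ i, ⋂ j, ⋂ (_ : i < j), {x | x j < x i}) ∩ ⋂ i, {x | 0 < x i} := by
    ext x
    simp [SigmaN]
  rw [h]
  refine MeasurableSet.inter ?_ ?_
  · exact MeasurableSet.iInter fun i => MeasurableSet.iInter fun j => MeasurableSet.iInter fun _ =>
      measurableSet_lt (by fun_prop) (by fun_prop)
  · exact MeasurableSet.iInter fun i => measurableSet_lt (by fun_prop) (by fun_prop)

/-- The mass of a symmetric set is controlled by the mass of its part in the chamber. -/
lemma setIntegral_le_mul_setIntegral_inter_SigmaN {m : ℕ} {S : Set (Fin m → ℝ)}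
    (hS : MeasurableSet S) (hsym : ∀ ε σ, ∀ x ∈ S, signedPerm ε σ x ∈ S) :
    ∫ x in S, ensembleDensity m x ≤
      2 ^ m * m.factorial * ∫ x in S ∩ SigmaN m, ensembleDensity m x := by
  have hm := hS.inter (measurableSet_SigmaN m)
  set F := (S ∩ SigmaN m).indicator (ensembleDensity m) with hF
  have hFint : Integrable F := (integrable_ensembleDensity m).indicator hm
  have hFnn : ∀ x, 0 ≤ F x := fun x =>
    Set.indicator_nonneg (fun y _ => ensembleDensity_nonneg m y) x
  have hcomp : ∀ ε σ, Integrable fun x => F (signedPerm ε σ x) := fun ε σ =>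
    (measurePreserving_signedPerm ε σ).integrable_comp_of_integrable hFint
  have hcompval : ∀ ε σ, ∫ x, F (signedPerm ε σ x) = ∫ x, F x := by
    intro ε σ
    have hmp := measurePreserving_signedPerm ε σ
    have h := integral_map (μ := volume) hmp.measurable.aemeasurable
      (f := F) (by rw [hmp.map_eq]; exact hFint.aestronglyMeasurable)
    rw [hmp.map_eq] at h
    exact h.symm
  have hsum : ∫ x, ∑ ε : Fin m → ℤˣ, ∑ σ : Equiv.Perm (Fin m), F (signedPerm ε σ x) =
      2 ^ m * m.factorial * ∫ x, F x := by
    rw [integral_finsetSum _ fun ε _ => integrable_finsetSum _ fun σ _ => hcomp ε σ]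
    simp only [integral_finsetSum _ fun σ _ => hcomp _ σ, hcompval, Finset.sum_const,
      Finset.card_univ, Fintype.card_perm, Fintype.card_fin, nsmul_eq_mul, Fintype.card_pi,
      Fintype.card_units_int, Finset.prod_const]
    push_cast
    ring
  rw [← integral_indicator hS, ← integral_indicator hm, ← hsum]
  have hae : ∀ᵐ x : Fin m → ℝ, ∀ i, x i ≠ 0 := by
    rw [ae_all_iff]
    intro i
    exact Measure.ae_eval_ne (μ := fun _ : Fin m => (volume : Measure ℝ)) i 0
  refine integral_mono_ae ((integrable_ensembleDensity m).indicator hS)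
    (integrable_finsetSum _ fun ε _ => integrable_finsetSum _ fun σ _ => hcomp ε σ) ?_
  filter_upwards [hae] with x hx0
  have hnn : 0 ≤ ∑ ε : Fin m → ℤˣ, ∑ σ : Equiv.Perm (Fin m), F (signedPerm ε σ x) :=
    Finset.sum_nonneg fun ε _ => Finset.sum_nonneg fun σ _ => hFnn _
  by_cases hx : x ∈ S
  swap
  · rwa [Set.indicator_of_notMem hx]
  rw [Set.indicator_of_mem hx]
  by_cases hne : ∀ i j, i ≠ j → x i ^ 2 ≠ x j ^ 2
  · obtain ⟨ε, σ, h⟩ := exists_signedPerm_mem_SigmaN hx0 hne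
    have hval : F (signedPerm ε σ x) = ensembleDensity m x := by
      have hmem : signedPerm ε σ x ∈ S ∩ SigmaN m := ⟨hsym ε σ x hx, h⟩
      rw [hF, Set.indicator_of_mem hmem, ensembleDensity_signedPerm]
    rw [← hval]
    refine (Finset.single_le_sum (f := fun τ => F (signedPerm ε τ x))
      (fun _ _ => hFnn _) (Finset.mem_univ σ)).trans ?_
    exact Finset.single_le_sum (f := fun η => ∑ τ, F (signedPerm η τ x))
      (fun _ _ => Finset.sum_nonneg fun _ _ => hFnn _) (Finset.mem_univ ε)
  · push Not at hne
    obtain ⟨i, j, hij, h⟩ := hne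
    rwa [ensembleDensity_eq_zero hij h]

lemma signedPerm_mem_shellSet {m : ℕ} {a b δ : ℝ} (ε : Fin m → ℤˣ) (σ : Equiv.Perm (Fin m))
    (x : Fin m → ℝ) (hx : x ∈ shellSet m a b δ) : signedPerm ε σ x ∈ shellSet m a b δ := by
  obtain ⟨h1, h2⟩ := hx
  refine ⟨by rwa [sum_signedPerm_sq], fun i => ?_⟩
  rw [signedPerm_apply_sq]
  exact h2 _

lemma Zn_pos (n : ℕ) : 0 < Zn n := by
  have := Real.pi_pos
  unfold Zn; positivity

lemma totalMass_eq_mul_Zn (m : ℕ) : totalMass m = 2 ^ m * m.factorial * Zn (2 * m) := by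
  have hsqrt : √(2 * Real.pi) = 2 * √(Real.pi / 2) := by
    rw [show 2 * Real.pi = 2 ^ 2 * (Real.pi / 2) by ring, Real.sqrt_mul (by norm_num),
      Real.sqrt_sq (by norm_num)]
  have hpow : (Real.pi / 2) ^ (((2 * m : ℕ) : ℝ) / 4) = √(Real.pi / 2) ^ m := by
    rw [Real.sqrt_eq_rpow, ← Real.rpow_natCast, ← Real.rpow_mul (by positivity)]
    congr 1
    push_cast
    ring
  rw [totalMass, Zn, hpow, hsqrt, Nat.mul_div_cancel_left m (by norm_num),
    Finset.prod_mul_distrib, Finset.prod_const, Finset.card_univ, Fintype.card_fin, mul_pow,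
    Fin.prod_univ_eq_prod_range fun j => ((2 * j).factorial : ℝ)]
  ring

/-- Lower bound for the normalized mass of the part of a contracted shell in the chamber. -/
lemma pow_mul_le_normalized_setIntegral {m : ℕ} (hm : 0 < m) {t r s δ : ℝ} (ht : 0 < t)
    (ht1 : t ≤ 1) (hr : 0 < r) (hr1 : r < 1) (hs : 1 < s) (hδ : 0 < δ) :
    (t * Real.exp ((1 - t ^ 2) * r ^ 2 / 2)) ^ (2 * m).choose 2 *
      (1 - chernoffBase r ^ (2 * m).choose 2 - chernoffBase s ^ (2 * m).choose 2
        - 60 * (m : ℝ) ^ 3 / (δ * ((2 * m).choose 2 : ℝ)) ^ 2) ≤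
      (Zn (2 * m))⁻¹ * ∫ x in shellSet m (t ^ 2 * r ^ 2) (t ^ 2 * s ^ 2) (t ^ 2 * δ) ∩ SigmaN m,
        ensembleDensity m x := by
  have h1 := totalMass_mul_le_setIntegral_shellSet hm hr hr1 hs hδ
  have h2 := pow_mul_setIntegral_shellSet_le m (a := r ^ 2) (b := s ^ 2) (δ := δ) ht ht1
  have h3 := setIntegral_le_mul_setIntegral_inter_SigmaN
    (measurableSet_shellSet m (t ^ 2 * r ^ 2) (t ^ 2 * s ^ 2) (t ^ 2 * δ)) signedPerm_mem_shellSet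
  have h4 := (mul_le_mul_of_nonneg_left h1 (by positivity)).trans (h2.trans h3)
  have hZ := Zn_pos (2 * m)
  rw [totalMass_eq_mul_Zn] at h4
  rw [inv_mul_eq_div, le_div_iff₀ hZ]
  have hpos : (0 : ℝ) < 2 ^ m * m.factorial := by positivity
  refine le_of_mul_le_mul_left ?_ hpos
  refine le_trans (le_of_eq ?_) h4
  ring

lemma cast_two_mul_choose_two (m : ℕ) :
    ((2 * m).choose 2 : ℝ) = 2 * (m : ℝ) ^ 2 - m := by
  rw [Nat.cast_choose_two]
  push_cast
  ring

open Filter Topology in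
lemma tendsto_concentration_error {r s δ : ℝ} (hr : 0 < r) (hr1 : r < 1) (hs : 1 < s) :
    Tendsto (fun m : ℕ => 1 - chernoffBase r ^ (2 * m).choose 2
      - chernoffBase s ^ (2 * m).choose 2
      - 60 * (m : ℝ) ^ 3 / (δ * ((2 * m).choose 2 : ℝ)) ^ 2) atTop (𝓝 1) := by
  have hN : Tendsto (fun m : ℕ => (2 * m).choose 2) atTop atTop := by
    refine tendsto_atTop_mono (fun m => ?_) tendsto_id
    rw [two_mul_choose_two_eq]
    exact Nat.le_add_left _ _
  have hs0 : 0 < s := zero_lt_one.trans hs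
  have h1 := (tendsto_pow_atTop_nhds_zero_of_lt_one (chernoffBase_nonneg hr)
    (chernoffBase_lt_one hr hr1.ne)).comp hN
  have h2 := (tendsto_pow_atTop_nhds_zero_of_lt_one (chernoffBase_nonneg hs0)
    (chernoffBase_lt_one hs0 hs.ne')).comp hN
  have hinv : Tendsto (fun m : ℕ => (m : ℝ)⁻¹) atTop (𝓝 0) := tendsto_inv_atTop_nhds_zero_nat
  have h3 : Tendsto (fun m : ℕ => 60 * (m : ℝ) ^ 3 / (δ * ((2 * m).choose 2 : ℝ)) ^ 2)
      atTop (𝓝 0) := by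
    have h4 : Tendsto (fun m : ℕ => 60 / δ ^ 2 * (m : ℝ)⁻¹ / (2 - (m : ℝ)⁻¹) ^ 2) atTop
        (𝓝 (60 / δ ^ 2 * 0 / (2 - 0) ^ 2)) :=
      (hinv.const_mul _).div ((hinv.const_sub 2).pow 2) (by norm_num)
    rw [mul_zero, zero_div] at h4
    refine h4.congr' ?_
    filter_upwards [eventually_gt_atTop 0] with m hm
    have hm' : (m : ℝ) ≠ 0 := by positivity
    rw [cast_two_mul_choose_two, show 2 * (m : ℝ) ^ 2 - m = m ^ 2 * (2 - (m : ℝ)⁻¹) by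
      field_simp]
    field_simp
  simpa using ((h1.const_sub 1).sub h2).sub h3

open Filter Topology in
lemma tendsto_rate (ℓ c : ℝ) :
    Tendsto (fun m : ℕ => 4 / (2 * m : ℝ) ^ 2 * (((2 * m).choose 2 : ℝ) * (ℓ / 2) + c)) atTop
      (𝓝 ℓ) := by
  have hinv : Tendsto (fun m : ℕ => (m : ℝ)⁻¹) atTop (𝓝 0) := tendsto_inv_atTop_nhds_zero_nat
  have h : Tendsto (fun m : ℕ => ℓ - (ℓ / 2) * (m : ℝ)⁻¹ + c * (m : ℝ)⁻¹ ^ 2) atTop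
      (𝓝 (ℓ - (ℓ / 2) * 0 + c * 0 ^ 2)) :=
    ((hinv.const_mul _).const_sub _).add ((hinv.pow 2).const_mul _)
  simp only [mul_zero, sub_zero, ne_eq, OfNat.ofNat_ne_zero, not_false_eq_true, zero_pow,
    add_zero] at h
  refine h.congr' ?_
  filter_upwards [eventually_gt_atTop 0] with m hm
  have hm' : (m : ℝ) ≠ 0 := by positivity
  rw [cast_two_mul_choose_two]
  field_simp
  ring

lemma SigABD_two_mul (m : ℕ) (a b δ : ℝ) :
    SigABD (2 * m) a b δ = shellSet (2 * m / 2) a b δ ∩ SigmaN (2 * m / 2) := by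
  have h : 2 * (2 * m / 2) = 2 * m := by lia
  ext x
  simp only [SigABD, shellSet, Set.mem_inter_iff, Set.mem_ofPred_eq, h]
  tauto

open Filter Topology in
lemma exists_contraction_parameters {a b y : ℝ} (ha : 0 < a) (hab : a < b)
    (hy : y < 1 - b + Real.log b) :
    ∃ c r : ℝ, 0 < c ∧ c < b ∧ 0 < r ∧ r < 1 ∧ a < c * r ^ 2 ∧
      y < Real.log c + (1 - c) * r ^ 2 := by
  have hb0 : b ≠ 0 := (ha.trans hab).ne'
  have hcont : ContinuousAt (fun c => 1 - c + Real.log c) b :=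
    (continuousAt_const.sub continuousAt_id).add (Real.continuousAt_log hb0)
  obtain ⟨c, ⟨hc1, hc2⟩, hc3⟩ : ∃ c, (y < 1 - c + Real.log c ∧ a < c) ∧ c < b := by
    have h1 : ∀ᶠ c in 𝓝[<] b, y < 1 - c + Real.log c ∧ a < c :=
      ((hcont.eventually (lt_mem_nhds hy)).and (lt_mem_nhds hab)).filter_mono nhdsWithin_le_nhds
    exact (h1.and self_mem_nhdsWithin).exists
  have hcr : ContinuousAt (fun r : ℝ => Real.log c + (1 - c) * r ^ 2) 1 := by fun_prop
  have hcr' : ContinuousAt (fun r : ℝ => c * r ^ 2) 1 := by fun_prop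
  obtain ⟨r, ⟨hr1, hr2, hr3⟩, hr4⟩ : ∃ r : ℝ,
      (y < Real.log c + (1 - c) * r ^ 2 ∧ a < c * r ^ 2 ∧ 0 < r) ∧ r < 1 := by
    have h1 : ∀ᶠ r : ℝ in 𝓝[<] 1,
        y < Real.log c + (1 - c) * r ^ 2 ∧ a < c * r ^ 2 ∧ 0 < r :=
      ((hcr.eventually (lt_mem_nhds (by linarith))).and
        ((hcr'.eventually (lt_mem_nhds (by linarith))).and
          (lt_mem_nhds zero_lt_one))).filter_mono nhdsWithin_le_nhds
    exact (h1.and self_mem_nhdsWithin).exists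
  exact ⟨c, r, ha.trans hc2, hc3, hr3, hr4, hr2, hr1⟩

theorem stmt9 (a b δ : ℝ) (ha : 0 < a) (hab : a < b) (hb : b ≤ 1) (hδ : 0 < δ) :
    ((1 - b + Real.log b : ℝ) : EReal) ≤ Filter.liminf (fun m : ℕ =>
      (((4 / (2 * m : ℝ) ^ 2) * Real.log (∫ μ in SigABD (2 * m) a b δ,
          (Zn (2 * m))⁻¹ * (VdM ((2 * m) / 2) μ) ^ 2
            * Real.exp (-(∑ j, μ j ^ 2) / 2)) : ℝ) : EReal))
      Filter.atTop := by
  rw [← EReal.ge_of_forall_gt_iff_ge]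
  intro y hy
  rw [EReal.coe_lt_coe_iff] at hy
  obtain ⟨c, r, hc0, hcb, hr0, hr1, hacr, hyc⟩ := exists_contraction_parameters ha hab hy
  set s := √(b / c) with hs
  have hs1 : 1 < s := by
    rw [hs, Real.lt_sqrt zero_le_one, one_pow, lt_div_iff₀ hc0]
    linarith
  have hs2 : c * s ^ 2 = b := by
    rw [hs, Real.sq_sqrt (div_nonneg (hc0.trans hcb).le hc0.le)]
    field_simp
  have ht2 : √c ^ 2 = c := Real.sq_sqrt hc0.le
  have ht0 : 0 < √c := Real.sqrt_pos.mpr hc0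
  have ht1 : √c ≤ 1 := Real.sqrt_le_one.mpr (hcb.le.trans hb)
  set ℓ := Real.log c + (1 - c) * r ^ 2 with hℓ
  set q := √c * Real.exp ((1 - √c ^ 2) * r ^ 2 / 2) with hq
  have hq0 : 0 < q := mul_pos ht0 (Real.exp_pos _)
  have hlogq : Real.log q = ℓ / 2 := by
    rw [hq, Real.log_mul ht0.ne' (Real.exp_pos _).ne', Real.log_exp, ht2, Real.log_sqrt hc0.le]
    ring
  refine Filter.le_liminf_of_le (by isBoundedDefault) ?_
  filter_upwards [(tendsto_rate ℓ (Real.log (1 / 2))).eventually (lt_mem_nhds hyc),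
    (tendsto_concentration_error (δ := δ / c) hr0 hr1 hs1).eventually
      (lt_mem_nhds (by norm_num : (1 / 2 : ℝ) < 1)),
    Filter.eventually_gt_atTop 0] with m hm1 hm2 hm0
  rw [EReal.coe_le_coe_iff]
  refine hm1.le.trans (mul_le_mul_of_nonneg_left ?_ (by positivity))
  have hk : ((2 * m / 2 : ℕ) : ℝ) = m := by
    rw [Nat.mul_div_cancel_left m two_pos]
  have hmain := pow_mul_le_normalized_setIntegral (m := 2 * m / 2) (by lia) ht0 ht1 hr0 hr1 hs1
    (div_pos hδ hc0)
  rw [ht2, hs2, mul_div_cancel₀ δ hc0.ne',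
    show 2 * (2 * m / 2) = 2 * m by lia, hk] at hmain
  have hsub : shellSet (2 * m / 2) (c * r ^ 2) b δ ⊆ shellSet (2 * m / 2) a b δ := by
    rintro x ⟨⟨h1, h2⟩, h3⟩
    exact ⟨⟨(mul_le_mul_of_nonneg_right hacr.le (Nat.cast_nonneg _)).trans_lt h1, h2⟩, h3⟩
  have hmono : ∫ x in shellSet (2 * m / 2) (c * r ^ 2) b δ ∩ SigmaN (2 * m / 2),
      ensembleDensity (2 * m / 2) x ≤ ∫ x in SigABD (2 * m) a b δ,
        ensembleDensity (2 * m / 2) x := by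
    rw [SigABD_two_mul]
    exact setIntegral_mono_set (integrable_ensembleDensity _).integrableOn
      (Filter.Eventually.of_forall fun x => ensembleDensity_nonneg _ x)
      (Set.inter_subset_inter_left _ hsub).eventuallyLE
  have hbound : q ^ (2 * m).choose 2 * (1 / 2) ≤ (Zn (2 * m))⁻¹ *
      ∫ x in SigABD (2 * m) a b δ, ensembleDensity (2 * m / 2) x := by
    refine le_trans ?_ (hmain.trans (mul_le_mul_of_nonneg_left hmono
      (inv_nonneg.mpr (Zn_pos _).le)))
    rw [hq, ht2]
    exact mul_le_mul_of_nonneg_left hm2.le (by positivity)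
  have hlog := Real.log_le_log (by positivity) hbound
  rw [Real.log_mul (by positivity) (by norm_num), Real.log_pow, hlogq] at hlog
  refine hlog.trans_eq ?_
  rw [← integral_const_mul]
  simp only [ensembleDensity, mul_assoc]
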